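/- arXiv:2312.00390 — 9 statements merged into one kernel-verified Lean document; each statement's English description precedes it below -/
import Mathlib

section
/- Let R be a nonzero commutative ring of positive characteristic. Then every polynomial f ∈ R[x] is eventually T-periodic, i.e., there exist m ≥ 0 and n ≥ 1 such that T^{m+n}(f) = T^m(f). -/
open Polynomial
open scoped Classical

/-- The Collatz map on `R[x]`: `T(f) = f·(x+1) − f₀` if the constant coefficient `f₀`
of `f` is nonzero, and `T(f) = f/x` otherwise. -/
noncomputable def collatzT (R : Type*) [CommRing R] (f : R[X]) : R[X] :=
  if f.coeff 0 ≠ 0 then f * (X + 1) - C (f.coeff 0) else f.divX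

/-- Multiplying by `X + 1`, removing the constant term and dividing by `X` adds `divX`. -/
theorem divX_mul_X_add_one_sub_C {R : Type*} [CommRing R] (f : R[X]) :
    (f * (X + 1) - C (f.coeff 0)).divX = f + f.divX := by
  ext n
  simp [coeff_divX, mul_add]

theorem iterate_divX_eq_zero {R : Type*} [CommRing R] (f : R[X]) {i : ℕ}
    (hi : f.natDegree < i) : divX^[i] f = 0 := by
  have key : ∀ k n, (divX^[k] f).coeff n = f.coeff (n + k) := by
    intro k
    induction k with
    | zero => simp
    | succ k ih =>
      intro n
      rw [Function.iterate_succ_apply', coeff_divX, ih]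
      congr 1
      ring
  ext n
  rw [key, coeff_zero]
  exact coeff_eq_zero_of_natDegree_lt (by omega)

/-- In positive characteristic, every polynomial lies in a finite additive subgroup that is
stable under `divX`. -/
theorem exists_finite_addSubgroup_divX_mem {R : Type*} [CommRing R] (N : ℕ) (hN : N ≠ 0)
    [CharP R N] (f : R[X]) :
    ∃ Q : AddSubgroup R[X], (Q : Set R[X]).Finite ∧ f ∈ Q ∧ ∀ g ∈ Q, g.divX ∈ Q := by
  have : NeZero N := ⟨hN⟩
  let _ : Algebra (ZMod N) R[X] := ZMod.algebra R[X] N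
  let s : Set R[X] := Set.range fun i : ℕ => divX^[i] f
  have hs : s.Finite := by
    refine (((Set.finite_Iic f.natDegree).image fun i : ℕ => divX^[i] f).insert 0).subset ?_
    rintro _ ⟨i, rfl⟩
    by_cases hi : f.natDegree < i
    · exact Or.inl (iterate_divX_eq_zero f hi)
    · exact Or.inr ⟨i, not_lt.mp hi, rfl⟩
  have : Module.Finite (ZMod N) (Submodule.span (ZMod N) s) := Module.Finite.span_of_finite _ hs
  have hfin : Finite (Submodule.span (ZMod N) s) := Module.finite_of_finite (ZMod N)
  refine ⟨(Submodule.span (ZMod N) s).toAddSubgroup, Set.toFinite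
    (Submodule.span (ZMod N) s : Set R[X]), Submodule.subset_span ⟨0, rfl⟩, ?_⟩
  have hle : Submodule.span (ZMod N) s ≤
      (Submodule.span (ZMod N) s).comap (AddMonoidHom.toZModLinearMap N divX_hom) := by
    rw [Submodule.span_le]
    rintro _ ⟨i, rfl⟩
    exact Submodule.subset_span ⟨i + 1, Function.iterate_succ_apply' divX i f⟩
  exact fun g hg => hle hg

/-- In positive characteristic, every polynomial is eventually `T`-periodic. -/
theorem stmt1 (R : Type*) [CommRing R] [Nontrivial R] (N : ℕ) (hN : N ≠ 0) [CharP R N]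
    (f : R[X]) :
    ∃ m : ℕ, ∃ n ≥ 1, (collatzT R)^[m + n] f = (collatzT R)^[m] f := by
  obtain ⟨Q, hQ, hf, hdiv⟩ := exists_finite_addSubgroup_divX_mem N hN f
  let up : R[X] → R[X] := fun g => g * (X + 1) - C (g.coeff 0)
  have hmem : ∀ k, (collatzT R)^[k] f ∈ (Q : Set R[X]) ∪ up '' Q := by
    intro k
    induction k with
    | zero => exact Or.inl hf
    | succ k ih =>
      rw [Function.iterate_succ_apply']
      rcases ih with h | ⟨g, hg, h⟩
      · by_cases h0 : ((collatzT R)^[k] f).coeff 0 = 0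
        · rw [collatzT, if_neg (not_not.mpr h0)]
          exact Or.inl (hdiv _ h)
        · rw [collatzT, if_pos h0]
          exact Or.inr ⟨_, h, rfl⟩
      · have h0 : (up g).coeff 0 = 0 := by simp [up, mul_add]
        rw [← h, collatzT, if_neg (not_not.mpr h0), divX_mul_X_add_one_sub_C]
        exact Or.inl (Q.add_mem hg (hdiv g hg))
  obtain ⟨a, b, hab, h⟩ := (hQ.union (hQ.image up)).exists_lt_map_eq_of_forall_mem hmem
  exact ⟨a, b - a, by omega, by rw [Nat.add_sub_cancel' hab.le, h]⟩
end

section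
/- Let R be a nonzero commutative ring of positive characteristic N = p₁^{α₁}⋯p_s^{α_s}, where p₁,…,p_s are distinct primes and α₁,…,α_s ≥ 1. Let f = Σ_{k=0}^{n} b_k x^k ∈ R[x] be a T-periodic polynomial with b₀ ≠ 0, b_n ≠ 0 and n = deg(f) ≥ 1. Then the period ρ_T(f) divides 2·Π_{i=1}^{s} p_i^{α_i + ⌊log_{p_i}(n)⌋}. -/
open Polynomial
open scoped Classical

section Dynamics

open Function

variable {R : Type*} [CommRing R]

/-- The degree of `g`, increased by one when the constant coefficient does not vanish. The Collatz
map never increases this weight. -/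
noncomputable def collatzWeight (g : R[X]) : ℕ :=
  g.natDegree + if g.coeff 0 ≠ 0 then 1 else 0

/-- Removing the constant term and dividing by `X`, as an `R`-linear endomorphism. -/
noncomputable def divXEnd (R : Type*) [CommRing R] : Module.End R R[X] where
  toFun := divX
  map_add' _ _ := divX_add
  map_smul' a g := by
    ext i
    simp [coeff_divX]

theorem coeff_zero_collatzT {g : R[X]} (hg : g.coeff 0 ≠ 0) : (collatzT R g).coeff 0 = 0 := by
  simp [collatzT, hg, mul_add]

theorem collatzT_collatzT {g : R[X]} (hg : g.coeff 0 ≠ 0) :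
    collatzT R (collatzT R g) = g + g.divX := by
  have h := coeff_zero_collatzT hg
  rw [collatzT, if_neg (not_not.mpr h), collatzT, if_pos hg]
  ext i
  simp [coeff_divX, mul_add]

theorem collatzWeight_collatzT_le (g : R[X]) :
    collatzWeight (collatzT R g) ≤ collatzWeight g := by
  by_cases hg : g.coeff 0 = 0
  · have hT : collatzT R g = g.divX := by simp [collatzT, hg]
    rw [hT, collatzWeight, collatzWeight, natDegree_divX_eq_natDegree_tsub_one]
    by_cases hd : g.natDegree = 0
    · have h1 : g.coeff 1 = 0 := coeff_eq_zero_of_natDegree_lt (by omega)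
      simp [hd, coeff_divX, h1]
    · split_ifs <;> omega
  · have h := coeff_zero_collatzT hg
    have hdeg : (collatzT R g).natDegree ≤ g.natDegree + 1 := by
      rw [collatzT, if_pos hg, natDegree_sub_C]
      refine natDegree_mul_le.trans (Nat.add_le_add_left ?_ _)
      simpa using (natDegree_add_C (p := (X : R[X])) (a := 1)).le.trans natDegree_X_le
    simpa [collatzWeight, h, hg] using hdeg

theorem collatzWeight_iterate_antitone (f : R[X]) :
    Antitone fun k => collatzWeight ((collatzT R)^[k] f) :=
  antitone_nat_of_succ_le fun k => by
    rw [iterate_succ_apply']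
    exact collatzWeight_collatzT_le _

theorem collatzWeight_iterate_of_mem_periodicPts {f : R[X]} (hf : f ∈ periodicPts (collatzT R))
    (k : ℕ) : collatzWeight ((collatzT R)^[k] f) = collatzWeight f := by
  obtain ⟨n, hn, hper⟩ := hf
  refine le_antisymm (collatzWeight_iterate_antitone f (Nat.zero_le k)) ?_
  have h := collatzWeight_iterate_antitone f (Nat.le_mul_of_pos_left k hn)
  have hfix : (collatzT R)^[n * k] f = f := hper.mul_const k
  simpa only [hfix] using h

theorem coeff_zero_collatzT_ne_zero {g : R[X]} (hg : g.coeff 0 = 0) (hpos : 0 < collatzWeight g)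
    (hw : collatzWeight (collatzT R g) = collatzWeight g) : (collatzT R g).coeff 0 ≠ 0 := by
  intro h
  have hT : collatzT R g = g.divX := by simp [collatzT, hg]
  have hdeg := natDegree_divX_eq_natDegree_tsub_one (p := g)
  simp only [collatzWeight, hg, h, ne_eq, not_true_eq_false, if_false, add_zero] at hpos hw
  rw [hT] at hw
  omega

theorem coeff_zero_iterate_two_mul_ne_zero {f : R[X]} (h0 : f.coeff 0 ≠ 0)
    (hf : f ∈ periodicPts (collatzT R)) (k : ℕ) : ((collatzT R)^[2 * k] f).coeff 0 ≠ 0 := by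
  have hw := collatzWeight_iterate_of_mem_periodicPts hf
  have hpos : 0 < collatzWeight f := by simp [collatzWeight, h0]
  induction k with
  | zero => simpa using h0
  | succ k ih =>
    have hodd := coeff_zero_collatzT ih
    rw [← iterate_succ_apply' (collatzT R)] at hodd
    rw [show 2 * (k + 1) = (2 * k).succ.succ by omega, iterate_succ_apply']
    refine coeff_zero_collatzT_ne_zero hodd ?_ ?_
    · rwa [hw]
    · rw [← iterate_succ_apply' (collatzT R), hw, hw]

theorem iterate_two_mul_collatzT {f : R[X]} (h0 : f.coeff 0 ≠ 0)
    (hf : f ∈ periodicPts (collatzT R)) (k : ℕ) :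
    (collatzT R)^[2 * k] f = ((1 + divXEnd R) ^ k) f := by
  induction k with
  | zero => simp
  | succ k ih =>
    rw [show 2 * (k + 1) = (2 * k).succ.succ by omega, iterate_succ_apply', iterate_succ_apply',
      collatzT_collatzT (coeff_zero_iterate_two_mul_ne_zero h0 hf k), ih, pow_succ']
    rfl

theorem coeff_divX_hom_pow (f : R[X]) (j i : ℕ) :
    ((divXEnd R ^ j) f).coeff i = f.coeff (i + j) := by
  induction j generalizing i with
  | zero => simp
  | succ j ih =>
    rw [pow_succ', Module.End.mul_apply]
    change (divX _).coeff i = _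
    rw [coeff_divX, ih]
    congr 1
    ring

theorem one_add_divX_hom_pow_apply_eq_self {N M : ℕ} [CharP R N] {f : R[X]}
    (h : ∀ j, j ≠ 0 → j ≤ f.natDegree → N ∣ M.choose j) :
    ((1 + divXEnd R) ^ M) f = f := by
  ext i
  rw [add_comm, (Commute.one_right _).add_pow, LinearMap.sum_apply, finsetSum_coeff,
    Finset.sum_eq_single 0]
  · simp
  · intro j _ hj
    rw [one_pow, mul_one, ← nsmul_eq_mul', LinearMap.smul_apply,
      coeff_smul, coeff_divX_hom_pow]
    by_cases hjn : j ≤ f.natDegree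
    · rw [nsmul_eq_mul, (CharP.cast_eq_zero_iff R N _).mpr (h j hj hjn), zero_mul]
    · rw [coeff_eq_zero_of_natDegree_lt (by omega), smul_zero]
  · simp

end Dynamics

theorem Nat.Prime.pow_dvd_choose_of_pow_add_log_dvd {p a n M j : ℕ} (hp : p.Prime)
    (hM : p ^ (a + Nat.log p n) ∣ M) (hj : j ≠ 0) (hjn : j ≤ n) : p ^ a ∣ M.choose j := by
  by_cases hc : M.choose j = 0
  · simp [hc]
  obtain ⟨i, rfl⟩ := Nat.exists_eq_succ_of_ne_zero hj
  have hM0 : M ≠ 0 := by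
    rintro rfl
    simp at hc
  obtain ⟨m, rfl⟩ := Nat.exists_eq_succ_of_ne_zero hM0
  have hdvd : p ^ (a + Nat.log p n) ∣ (m.succ).choose i.succ * i.succ := by
    rw [← Nat.add_one_mul_choose_eq]
    exact hM.mul_right _
  rw [hp.pow_dvd_iff_le_factorization (mul_ne_zero hc hj), Nat.factorization_mul hc hj,
    Finsupp.add_apply] at hdvd
  rw [hp.pow_dvd_iff_le_factorization hc]
  have hlog : (i.succ).factorization p ≤ Nat.log p n :=
    Nat.le_log_of_pow_le hp.one_lt ((Nat.ordProj_le p hj).trans hjn)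
  omega

/-- In positive characteristic `N = ∏ pᵢ^αᵢ`, the period of a `T`-periodic polynomial `f`
with nonzero constant coefficient, nonzero leading coefficient and `deg f ≥ 1`
divides `2·∏ pᵢ^(αᵢ + ⌊log_{pᵢ}(deg f)⌋)`. -/
theorem stmt2 (R : Type*) [CommRing R] [Nontrivial R] (s : ℕ) (hs : 1 ≤ s)
    (p α : Fin s → ℕ) (hp : ∀ i, (p i).Prime) (hinj : Function.Injective p)
    (hα : ∀ i, 1 ≤ α i) [CharP R (∏ i, p i ^ α i)]
    (f : R[X]) (h0 : f.coeff 0 ≠ 0) (hlead : f.leadingCoeff ≠ 0) (hd : 1 ≤ f.natDegree)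
    (hper : ∃ n ≥ 1, (collatzT R)^[n] f = f) :
    Function.minimalPeriod (collatzT R) f ∣
      2 * ∏ i, p i ^ (α i + Nat.log (p i) f.natDegree) := by
  have hf : f ∈ Function.periodicPts (collatzT R) := by
    obtain ⟨n, hn, h⟩ := hper
    exact ⟨n, hn, h⟩
  refine Function.IsPeriodicPt.minimalPeriod_dvd ?_
  rw [Function.IsPeriodicPt, Function.IsFixedPt, iterate_two_mul_collatzT h0 hf]
  refine one_add_divX_hom_pow_apply_eq_self (N := ∏ i, p i ^ α i) fun j hj hjn => ?_
  refine Finset.prod_dvd_of_isRelPrime (fun i _ k _ hik => ?_) fun i _ => ?_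
  · exact Nat.coprime_iff_isRelPrime.mp
      (((Nat.coprime_primes (hp i) (hp k)).mpr (hinj.ne hik)).pow _ _)
  · exact (hp i).pow_dvd_choose_of_pow_add_log_dvd
      (Finset.dvd_prod_of_mem (fun i => p i ^ (α i + Nat.log (p i) f.natDegree))
        (Finset.mem_univ i)) hj hjn
end

section
/- Let p be a prime and let a ≥ n ≥ 1 be integers such that v_p(a) ≥ ⌊log_p(n)⌋ + 1. Then v_p( C(a,n) ) = v_p(a) − v_p(n), where C(a,n) is the binomial coefficient 'a choose n'. -/
/-- If `p ^ e ∣ a` and `0 < k < p ^ e`, then `a - k` and `k` have the same `p`-adic valuation. -/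
theorem padicValNat_sub_eq_of_pow_dvd {p a k e : ℕ} [Fact p.Prime] (ha : p ^ e ∣ a)
    (hk : k ≠ 0) (hke : k < p ^ e) (hka : k < a) :
    padicValNat p (a - k) = padicValNat p k := by
  have hlt : padicValNat p k < e := by
    by_contra! h
    exact hke.not_ge (Nat.le_of_dvd (Nat.pos_of_ne_zero hk)
      ((pow_dvd_pow p h).trans pow_padicValNat_dvd))
  apply le_antisymm
  · by_contra! h
    have h₁ : p ^ (padicValNat p k + 1) ∣ a - k := (pow_dvd_pow p h).trans pow_padicValNat_dvd
    have h₂ : p ^ (padicValNat p k + 1) ∣ a := (pow_dvd_pow p hlt).trans ha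
    exact pow_succ_padicValNat_not_dvd hk ((Nat.dvd_sub_iff_right hka.le h₂).1 h₁)
  · rw [← padicValNat_dvd_iff_le (Nat.sub_ne_zero_of_lt hka)]
    exact Nat.dvd_sub ((pow_dvd_pow p hlt.le).trans ha) pow_padicValNat_dvd

/-- If `p ^ e ∣ b + 1` and `m < p ^ e`, then `b.choose m` has `p`-adic valuation zero for `m ≤ b`. -/
theorem padicValNat_choose_eq_zero_of_pow_dvd_succ {p b m e : ℕ} [Fact p.Prime]
    (hb : p ^ e ∣ b + 1) (hme : m < p ^ e) (hmb : m ≤ b) :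
    padicValNat p (b.choose m) = 0 := by
  induction m with
  | zero => simp
  | succ m ih =>
    have hval := congrArg (padicValNat p) (Nat.choose_succ_right_eq b m)
    rw [padicValNat.mul (Nat.choose_pos hmb).ne' m.add_one_ne_zero,
      padicValNat.mul (Nat.choose_pos (by omega)).ne' (by omega),
      ih (by omega) (by omega), ← Nat.add_sub_add_right b 1 m,
      padicValNat_sub_eq_of_pow_dvd hb m.add_one_ne_zero hme (by omega)] at hval
    omega

/-- If `a ≥ n ≥ 1` and `v_p(a) ≥ ⌊log_p n⌋ + 1`, then `v_p(C(a,n)) = v_p(a) − v_p(n)`. -/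
theorem stmt4 (p : ℕ) (hp : p.Prime) (a n : ℕ) (hn : 1 ≤ n) (hna : n ≤ a)
    (hv : Nat.log p n + 1 ≤ padicValNat p a) :
    padicValNat p (a.choose n) = padicValNat p a - padicValNat p n := by
  have : Fact p.Prime := ⟨hp⟩
  obtain ⟨b, rfl⟩ : ∃ b, a = b + 1 := ⟨a - 1, by omega⟩
  obtain ⟨m, rfl⟩ : ∃ m, n = m + 1 := ⟨n - 1, by omega⟩
  have hlt := Nat.lt_pow_succ_log_self hp.one_lt (m + 1)
  have hval := congrArg (padicValNat p) (Nat.add_one_mul_choose_eq b m)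
  rw [padicValNat.mul b.add_one_ne_zero (Nat.choose_pos (by omega)).ne',
    padicValNat.mul (Nat.choose_pos hna).ne' m.add_one_ne_zero,
    padicValNat_choose_eq_zero_of_pow_dvd_succ ((pow_dvd_pow p hv).trans pow_padicValNat_dvd)
      (m.lt_succ_self.trans hlt) (by omega)] at hval
  omega
end

section
/- Let p be a prime, and let α ≥ 1, r ≥ 0 and k ≥ p^r be integers. Assume that v_p( C(k,j) ) ≥ α for all integers j with 1 ≤ j ≤ p^r, where C(k,j) is the binomial coefficient. Then v_p(k) ≥ α + r. -/
theorem choose_pow_mul_sub_one_modEq_one (p : ℕ) [Fact p.Prime] (t q : ℕ) (hq : 0 < q) :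
    (p ^ t * q - 1).choose (p ^ t - 1) ≡ 1 [MOD p] := by
  have hp : 0 < p := (Fact.out : p.Prime).pos
  have key : ∀ a, 0 < a → (p * a - 1) % p = p - 1 ∧ (p * a - 1) / p = a - 1 := by
    intro a ha
    obtain ⟨b, rfl⟩ := Nat.exists_eq_add_of_lt ha
    have e : p * (0 + b + 1) - 1 = (p - 1) + p * b := by
      rw [zero_add, mul_add]; omega
    rw [e, Nat.add_mul_mod_self_left, Nat.add_mul_div_left _ _ hp, Nat.mod_eq_of_lt (by omega),
      Nat.div_eq_of_lt (by omega)]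
    omega
  induction t with
  | zero => simp [Nat.ModEq.refl]
  | succ t ih =>
    obtain ⟨h1, h2⟩ := key (p ^ t * q) (by positivity)
    obtain ⟨h3, h4⟩ := key (p ^ t) (by positivity)
    have h := Choose.choose_modEq_choose_mod_mul_choose_div_nat (p := p)
      (n := p * (p ^ t * q) - 1) (k := p * p ^ t - 1)
    rw [h1, h2, h3, h4, Nat.choose_self, one_mul] at h
    rw [pow_succ', mul_assoc]
    exact h.trans ih

theorem padicValNat_choose_pow_add (p : ℕ) [Fact p.Prime] (t k : ℕ) (hk : 0 < k)
    (ht : p ^ t ∣ k) : padicValNat p (k.choose (p ^ t)) + t = padicValNat p k := by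
  have hp : p.Prime := Fact.out
  have hpt : 0 < p ^ t := pow_pos hp.pos t
  obtain ⟨q, rfl⟩ := ht
  have hq : 0 < q := Nat.pos_of_mul_pos_left hk
  have hle : p ^ t ≤ p ^ t * q := Nat.le_mul_of_pos_right _ hq
  have hmod := choose_pow_mul_sub_one_modEq_one p t q hq
  have hnd : ¬ p ∣ (p ^ t * q - 1).choose (p ^ t - 1) := fun hd =>
    hp.one_lt.ne' (Nat.dvd_one.mp ((hmod.dvd_iff dvd_rfl).mp hd))
  have h := Nat.add_one_mul_choose_eq (p ^ t * q - 1) (p ^ t - 1)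
  rw [Nat.sub_add_cancel hk, Nat.sub_add_cancel hpt] at h
  have hv := congrArg (padicValNat p) h
  rw [padicValNat.mul hk.ne' (Nat.choose_pos (by omega)).ne',
    padicValNat.mul (Nat.choose_pos hle).ne' hpt.ne', padicValNat.prime_pow,
    padicValNat.eq_zero_of_not_dvd hnd, add_zero] at hv
  exact hv.symm

/-- If `k ≥ p^r` and `v_p(C(k,j)) ≥ α` for all `1 ≤ j ≤ p^r` (with `α ≥ 1`),
then `v_p(k) ≥ α + r`. -/
theorem stmt5 (p : ℕ) (hp : p.Prime) (α r k : ℕ) (hα : 1 ≤ α) (hk : p ^ r ≤ k)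
    (h : ∀ j, 1 ≤ j → j ≤ p ^ r → α ≤ padicValNat p (k.choose j)) :
    α + r ≤ padicValNat p k := by
  have : Fact p.Prime := ⟨hp⟩
  have hk0 : 0 < k := (pow_pos hp.pos r).trans_le hk
  have hmin := padicValNat_choose_pow_add p (min r (padicValNat p k)) k hk0
    ((pow_dvd_pow p (min_le_right _ _)).trans pow_padicValNat_dvd)
  have hα' := h (p ^ min r (padicValNat p k)) (pow_pos hp.pos _)
    (Nat.pow_le_pow_right hp.pos (min_le_left _ _))
  omega
end

section
/- Let p₁,…,p_s (s ≥ 1) be distinct primes, let α₁,…,α_s ≥ 1 be integers, and let k ≥ n ≥ 1 be integers. Then the following are equivalent: (1) the product Π_{i=1}^{s} p_i^{α_i + ⌊log_{p_i}(n)⌋} divides k; (2) the product Π_{i=1}^{s} p_i^{α_i} divides the binomial coefficient C(k,j) for every j with 1 ≤ j ≤ n. -/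
/-- If `p ^ m ∣ k`, the top and bottom entries of `(k - 1).choose (p ^ m - 1)` add without carries
in base `p`. -/
theorem factorization_pred_choose_pow_pred {p m k : ℕ} (hp : p.Prime) (hk : k ≠ 0)
    (h : p ^ m ∣ k) : ((k - 1).choose (p ^ m - 1)).factorization p = 0 := by
  have hpm : 0 < p ^ m := pow_pos hp.pos m
  have hle : p ^ m ≤ k := Nat.le_of_dvd (Nat.pos_of_ne_zero hk) h
  rw [Nat.factorization_choose hp (by omega) (Nat.lt_succ_self _), Finset.card_eq_zero,
    Finset.filter_eq_empty_iff]
  intro i _ hi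
  have hpi : 0 < p ^ i := pow_pos hp.pos i
  have hsub : k - 1 - (p ^ m - 1) = k - p ^ m := by omega
  have hdvd : p ^ m ∣ k - p ^ m := Nat.dvd_sub h dvd_rfl
  rw [hsub] at hi
  rcases le_total i m with him | him
  · have : (k - p ^ m) % p ^ i = 0 := Nat.mod_eq_zero_of_dvd ((pow_dvd_pow p him).trans hdvd)
    have := Nat.mod_lt (p ^ m - 1) hpi
    omega
  · have hmi : p ^ m ∣ p ^ i := pow_dvd_pow p him
    have hlt : (k - p ^ m) % p ^ i < p ^ i := Nat.mod_lt _ hpi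
    have hd : p ^ m ∣ p ^ i - (k - p ^ m) % p ^ i :=
      Nat.dvd_sub hmi ((Nat.dvd_mod_iff hmi).2 hdvd)
    have := Nat.le_of_dvd (by omega) hd
    have := Nat.mod_le (p ^ m - 1) (p ^ i)
    omega

theorem factorization_choose_pow_add {p m k : ℕ} (hp : p.Prime) (hk : k ≠ 0) (h : p ^ m ∣ k) :
    (k.choose (p ^ m)).factorization p + m = k.factorization p := by
  have hpm : 0 < p ^ m := pow_pos hp.pos m
  have hle : p ^ m ≤ k := Nat.le_of_dvd (Nat.pos_of_ne_zero hk) h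
  have key := Nat.add_one_mul_choose_eq (k - 1) (p ^ m - 1)
  rw [Nat.sub_add_cancel (by omega : 1 ≤ k), Nat.sub_add_cancel hpm] at key
  have hf := congrArg (fun x => x.factorization p) key
  rw [Nat.factorization_mul hk (Nat.choose_pos (by omega)).ne',
    Nat.factorization_mul (Nat.choose_pos hle).ne' hpm.ne', Finsupp.add_apply, Finsupp.add_apply,
    factorization_pred_choose_pow_pred hp hk h, hp.factorization_pow] at hf
  simpa using hf.symm

theorem pow_add_log_dvd_iff_forall_pow_dvd_choose {p a k n : ℕ} (hp : p.Prime) (ha : 1 ≤ a)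
    (hn : 1 ≤ n) (hkn : n ≤ k) :
    p ^ (a + Nat.log p n) ∣ k ↔ ∀ j, 1 ≤ j → j ≤ n → p ^ a ∣ k.choose j := by
  have hk : k ≠ 0 := by omega
  rw [hp.pow_dvd_iff_le_factorization hk]
  constructor
  · intro h j hj hjn
    rw [hp.pow_dvd_iff_le_factorization (Nat.choose_pos (hjn.trans hkn)).ne']
    have h1 : k.factorization p ≤ (k.choose j).factorization p + j.factorization p :=
      Nat.factorization_le_factorization_choose_add (hjn.trans hkn) (by omega)
    have h2 : j.factorization p ≤ Nat.log p n :=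
      Nat.le_log_of_pow_le hp.one_lt ((Nat.ordProj_le p (by omega)).trans hjn)
    omega
  · intro h
    have hchoose : ∀ m, m ≤ k.factorization p → m ≤ Nat.log p n → a + m ≤ k.factorization p := by
      intro m hmk hmn
      have hmn' : p ^ m ≤ n := Nat.pow_le_of_le_log (by omega) hmn
      have hdvd := h (p ^ m) (pow_pos hp.pos m) hmn'
      rw [hp.pow_dvd_iff_le_factorization (Nat.choose_pos (hmn'.trans hkn)).ne'] at hdvd
      have := factorization_choose_pow_add hp hk ((hp.pow_dvd_iff_le_factorization hk).2 hmk)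
      omega
    rcases le_total (Nat.log p n) (k.factorization p) with hv | hv
    · exact hchoose _ hv le_rfl
    · have := hchoose _ le_rfl hv
      omega

theorem prod_prime_pow_dvd_iff {ι : Type*} [Fintype ι] {p : ι → ℕ} (hp : ∀ i, (p i).Prime)
    (hinj : Function.Injective p) (e : ι → ℕ) (m : ℕ) :
    (∏ i, p i ^ e i) ∣ m ↔ ∀ i, p i ^ e i ∣ m := by
  refine ⟨fun h i => (Finset.dvd_prod_of_mem _ (Finset.mem_univ i)).trans h, fun h => ?_⟩
  refine Finset.prod_dvd_of_isRelPrime (fun i _ j _ hij => ?_) fun i _ => h i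
  exact Nat.coprime_iff_isRelPrime.1
    (Nat.Coprime.pow _ _ ((Nat.coprime_primes (hp i) (hp j)).2 (hinj.ne hij)))


/-- For distinct primes `p₁,…,p_s`, exponents `αᵢ ≥ 1` and `k ≥ n ≥ 1`:
`∏ pᵢ^(αᵢ + ⌊log_{pᵢ} n⌋) ∣ k` iff `∏ pᵢ^αᵢ ∣ C(k,j)` for all `1 ≤ j ≤ n`. -/
theorem stmt6 (s : ℕ) (hs : 1 ≤ s) (p α : Fin s → ℕ) (hp : ∀ i, (p i).Prime)
    (hinj : Function.Injective p) (hα : ∀ i, 1 ≤ α i)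
    (k n : ℕ) (hn : 1 ≤ n) (hkn : n ≤ k) :
    (∏ i, p i ^ (α i + Nat.log (p i) n)) ∣ k ↔
      ∀ j, 1 ≤ j → j ≤ n → (∏ i, p i ^ α i) ∣ k.choose j := by
  simp only [prod_prime_pow_dvd_iff hp hinj,
    fun i => pow_add_log_dvd_iff_forall_pow_dvd_choose (hp i) (hα i) hn hkn]
  exact ⟨fun h j hj hjn i => h i j hj hjn, fun h i j hj hjn => h j hj hjn i⟩
end

section
/- Let R be a nonzero commutative ring and let f ∈ R[x] be a nonzero polynomial. Then: (1) deg(T(f)) ≤ deg(f) + 1; (2) if deg(T(f)) > deg(f), then f has nonzero constant coefficient and T(f) has zero constant coefficient; (3) deg(T²(f)) ≤ deg(f); (4) for all j ≥ 0, deg(T^{2j}(f)) ≤ deg(f) and deg(T^{2j+1}(f)) ≤ deg(f) + 1. -/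
open Polynomial
open scoped Classical

theorem degree_divX_add_one {R : Type*} [CommRing R] {f : R[X]} (h : f.coeff 0 = 0) :
    f.divX.degree + 1 = f.degree := by
  nontriviality R
  conv_rhs => rw [← divX_mul_X_add f, h, C_0, add_zero, degree_mul_X]

theorem collatzT_of_coeff_zero_eq {R : Type*} [CommRing R] {f : R[X]} (h : f.coeff 0 = 0) :
    collatzT R f = f.divX := by
  simp [collatzT, h]

theorem collatzT_of_coeff_zero_ne {R : Type*} [CommRing R] {f : R[X]} (h : f.coeff 0 ≠ 0) :
    collatzT R f = f * (X + 1) - C (f.coeff 0) := by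
  simp [collatzT, h]

theorem coeff_zero_collatzT_of_ne {R : Type*} [CommRing R] {f : R[X]} (h : f.coeff 0 ≠ 0) :
    (collatzT R f).coeff 0 = 0 := by
  simp [collatzT_of_coeff_zero_ne h, mul_coeff_zero]

theorem degree_collatzT_add_one {R : Type*} [CommRing R] {f : R[X]} (h : f.coeff 0 = 0) :
    (collatzT R f).degree + 1 = f.degree := by
  rw [collatzT_of_coeff_zero_eq h, degree_divX_add_one h]

theorem degree_collatzT_le_of_coeff_zero_eq {R : Type*} [CommRing R] {f : R[X]}
    (h : f.coeff 0 = 0) : (collatzT R f).degree ≤ f.degree := by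
  rw [← degree_collatzT_add_one h]
  exact le_add_of_nonneg_right zero_le_one

theorem degree_collatzT_le {R : Type*} [CommRing R] (f : R[X]) :
    (collatzT R f).degree ≤ f.degree + 1 := by
  by_cases h : f.coeff 0 = 0
  · exact (degree_collatzT_le_of_coeff_zero_eq h).trans (le_add_of_nonneg_right zero_le_one)
  · have hf : f ≠ 0 := by rintro rfl; simp at h
    have hX : (X + 1 : R[X]).degree ≤ 1 := by compute_degree
    rw [collatzT_of_coeff_zero_ne h]
    refine (degree_sub_le _ _).trans (max_le ?_ ?_)
    · exact (degree_mul_le _ _).trans (by gcongr)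
    · exact degree_C_le.trans (add_nonneg (zero_le_degree_iff.2 hf) zero_le_one)

theorem degree_collatzT_collatzT_le {R : Type*} [CommRing R] (f : R[X]) :
    (collatzT R (collatzT R f)).degree ≤ f.degree := by
  by_cases h : f.coeff 0 = 0
  · exact (degree_collatzT_le _).trans (degree_collatzT_add_one h).le
  · have key := degree_collatzT_le f
    rw [← degree_collatzT_add_one (coeff_zero_collatzT_of_ne h)] at key
    exact (WithBot.add_le_add_iff_right WithBot.one_ne_bot).1 key

theorem degree_iterate_two_mul_collatzT_le {R : Type*} [CommRing R] (f : R[X]) (j : ℕ) :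
    ((collatzT R)^[2 * j] f).degree ≤ f.degree := by
  induction j with
  | zero => simp
  | succ j ih =>
    rw [mul_add_one, Function.iterate_succ_apply', Function.iterate_succ_apply']
    exact (degree_collatzT_collatzT_le _).trans ih

/-- Basic degree estimates for the Collatz map `T` on `R[x]`, for nonzero `f`. -/
theorem stmt7 (R : Type*) [CommRing R] [Nontrivial R] (f : R[X]) (hf : f ≠ 0) :
    (collatzT R f).degree ≤ f.degree + 1 ∧
    (f.degree < (collatzT R f).degree → f.coeff 0 ≠ 0 ∧ (collatzT R f).coeff 0 = 0) ∧
    ((collatzT R)^[2] f).degree ≤ f.degree ∧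
    (∀ j : ℕ, ((collatzT R)^[2 * j] f).degree ≤ f.degree ∧
      ((collatzT R)^[2 * j + 1] f).degree ≤ f.degree + 1) := by
  refine ⟨degree_collatzT_le f, fun h => ?_, degree_collatzT_collatzT_le f, fun j => ?_⟩
  · have h0 : f.coeff 0 ≠ 0 := fun h0 => h.not_ge (degree_collatzT_le_of_coeff_zero_eq h0)
    exact ⟨h0, coeff_zero_collatzT_of_ne h0⟩
  · refine ⟨degree_iterate_two_mul_collatzT_le f j, ?_⟩
    rw [Function.iterate_succ_apply']
    exact (degree_collatzT_le _).trans (by gcongr; exact degree_iterate_two_mul_collatzT_le f j)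
end

section
/- Let F_q be a finite field of characteristic p and let f ∈ F_q[x] be a polynomial of degree d. Then T^{p·d·(d+1) − d}(f) is T-periodic. -/
open Polynomial
open scoped Classical

namespace CollatzPoly

lemma apply_apply_collatzT {R : Type*} [CommRing R] {f : R[X]} (hf : f.coeff 0 ≠ 0) :
    collatzT R (collatzT R f) = f + f.divX := by
  have h : collatzT R f = f * (X + 1) - C (f.coeff 0) := if_pos hf
  have h0 : (collatzT R f).coeff 0 = 0 := by simp [h, mul_add]
  rw [collatzT, if_neg (not_not.mpr h0), h]
  ext n
  simp [coeff_divX, mul_add, coeff_C_succ]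

/-- The linear map `f ↦ f.divX`. -/
noncomputable def divXLinear (R : Type*) [CommRing R] : R[X] →ₗ[R] R[X] where
  toFun := divX
  map_add' _ _ := divX_add
  map_smul' c f := by ext n; simp [coeff_divX]

lemma coeff_divXLinear_pow {R : Type*} [CommRing R] (m n : ℕ) (f : R[X]) :
    ((divXLinear R ^ m) f).coeff n = f.coeff (n + m) := by
  induction m generalizing n with
  | zero => simp
  | succ m ih =>
    rw [pow_succ', Module.End.mul_apply]
    change (divX _).coeff n = _
    rw [coeff_divX, ih, add_right_comm, add_assoc]

lemma one_add_divXLinear_pow_apply {R : Type*} [CommRing R] (p : ℕ) [Fact p.Prime] [CharP R p]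
    (k : ℕ) {f : R[X]} (hf : f.natDegree < p ^ k) :
    ((1 + divXLinear R) ^ p ^ k) f = f := by
  have h : (1 + divXLinear R) ^ p ^ k = 1 + divXLinear R ^ p ^ k := by
    simpa using congrArg (aeval (divXLinear R)) (add_pow_char_pow (p := p) (n := k) (1 : R[X]) X)
  have h0 : (divXLinear R ^ p ^ k) f = 0 := by
    ext n
    rw [coeff_divXLinear_pow, coeff_eq_zero_of_natDegree_lt (by omega), coeff_zero]
  simp [h, h0]

lemma natDegree_one_add_divXLinear_pow_le {R : Type*} [CommRing R] (n : ℕ) (f : R[X]) :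
    (((1 + divXLinear R) ^ n) f).natDegree ≤ f.natDegree := by
  induction n with
  | zero => simp
  | succ n ih =>
    rw [pow_succ', Module.End.mul_apply]
    refine le_trans ?_ ih
    refine natDegree_add_le_of_degree_le le_rfl ?_
    exact (natDegree_divX_eq_natDegree_tsub_one).le.trans (Nat.sub_le _ _)

lemma iterate_two_mul_collatzT {R : Type*} [CommRing R] (n : ℕ) (f : R[X])
    (h : ∀ i < n, (((1 + divXLinear R) ^ i) f).coeff 0 ≠ 0) :
    (collatzT R)^[2 * n] f = ((1 + divXLinear R) ^ n) f := by
  induction n with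
  | zero => simp
  | succ n ih =>
    rw [mul_add_one, add_comm, Function.iterate_add_apply, ih fun i hi => h i (by omega),
      pow_succ', Module.End.mul_apply]
    exact apply_apply_collatzT (h n n.lt_succ_self)

lemma iterate_mem_periodicPts {α : Type*} {g : α → α} {x : α} {m n : ℕ}
    (hx : g^[m] x ∈ Function.periodicPts g) (hmn : m ≤ n) :
    g^[n] x ∈ Function.periodicPts g := by
  obtain ⟨l, rfl⟩ := Nat.exists_eq_add_of_le' hmn
  obtain ⟨k, hk, hp⟩ := hx
  rw [Function.iterate_add_apply]
  exact ⟨k, hk, hp.apply_iterate l⟩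

theorem iterate_collatzT_mem_periodicPts {R : Type*} [CommRing R] (p : ℕ) [Fact p.Prime]
    [CharP R p] (d : ℕ) (f : R[X]) (hf : f.natDegree ≤ d) :
    (collatzT R)^[p * d * (d + 1) - d] f ∈ Function.periodicPts (collatzT R) := by
  have hp : 1 < p := (Fact.out : p.Prime).one_lt
  induction d generalizing f with
  | zero =>
    replace hf := eq_C_of_natDegree_le_zero hf
    by_cases h0 : f.coeff 0 = 0
    · refine ⟨1, one_pos, ?_⟩
      have hf0 : f = 0 := by rw [hf, h0, C_0]
      simp [Function.IsPeriodicPt, Function.IsFixedPt, collatzT, hf0]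
    · refine ⟨2, two_pos, ?_⟩
      have h := apply_apply_collatzT h0
      have hd : f.divX = 0 := by rw [hf, divX_C]
      simpa [Function.IsPeriodicPt, Function.IsFixedPt, hd] using h
  | succ d ih =>
    obtain ⟨k, hk, hk'⟩ : ∃ k, d + 1 < p ^ k ∧ p ^ k ≤ p * (d + 1) := by
      refine ⟨Nat.log p (d + 1) + 1, Nat.lt_pow_succ_log_self hp _, ?_⟩
      rw [pow_succ']
      exact Nat.mul_le_mul_left _ (Nat.pow_log_le_self p d.succ_ne_zero)
    by_cases h : ∃ i < p ^ k, (((1 + divXLinear R) ^ i) f).coeff 0 = 0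
    · have hex : ∃ i : ℕ, (((1 + divXLinear R) ^ i) f).coeff 0 = 0 := by
        obtain ⟨i, _, hi⟩ := h
        exact ⟨i, hi⟩
      obtain ⟨n, hn, h0, hmin⟩ : ∃ n < p ^ k, (((1 + divXLinear R) ^ n) f).coeff 0 = 0 ∧
          ∀ i < n, (((1 + divXLinear R) ^ i) f).coeff 0 ≠ 0 := by
        obtain ⟨i, hi, hi0⟩ := h
        exact ⟨Nat.find hex, (Nat.find_min' hex hi0).trans_lt hi, Nat.find_spec hex,
          fun j hj => Nat.find_min hex hj⟩
      have hT : (collatzT R)^[2 * n + 1] f = (((1 + divXLinear R) ^ n) f).divX := by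
        rw [Function.iterate_succ_apply', iterate_two_mul_collatzT n f hmin, collatzT,
          if_neg (not_not.mpr h0)]
      have hdeg : ((collatzT R)^[2 * n + 1] f).natDegree ≤ d := by
        have := natDegree_one_add_divXLinear_pow_le n f
        rw [hT, natDegree_divX_eq_natDegree_tsub_one]
        omega
      have hper := ih _ hdeg
      rw [← Function.iterate_add_apply] at hper
      refine iterate_mem_periodicPts hper ?_
      have h1 : d ≤ p * d * (d + 1) := by nlinarith [Nat.zero_le (p * d * d)]
      have h2 : p * (d + 1) * (d + 1 + 1) = p * d * (d + 1) + 2 * (p * (d + 1)) := by ring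
      omega
    · push Not at h
      have hper : (collatzT R)^[0] f ∈ Function.periodicPts (collatzT R) := by
        refine ⟨2 * p ^ k, by positivity, ?_⟩
        exact (iterate_two_mul_collatzT _ f h).trans
          (one_add_divXLinear_pow_apply p k (hf.trans_lt hk))
      exact iterate_mem_periodicPts hper (Nat.zero_le _)

end CollatzPoly

/-- Over a finite field of characteristic `p`, for any polynomial `f` of degree `d`,
`T^[p·d·(d+1) − d] f` is `T`-periodic. -/
theorem stmt10 (F : Type*) [Field F] [Fintype F] (p : ℕ) [Fact p.Prime] [CharP F p]
    (f : F[X]) :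
    ∃ n ≥ 1,
      (collatzT F)^[n]
          ((collatzT F)^[p * f.natDegree * (f.natDegree + 1) - f.natDegree] f) =
        (collatzT F)^[p * f.natDegree * (f.natDegree + 1) - f.natDegree] f :=
  CollatzPoly.iterate_collatzT_mem_periodicPts p f.natDegree f le_rfl
end

section
/- Let F_q be a finite field of characteristic p and let f ∈ F_q[x] be a T-periodic polynomial with nonzero constant coefficient and degree d ≥ 1. Then the period of f is exactly 2·p^k, where k = 1 + ⌊log_p(d)⌋. -/
open Polynomial
open scoped Classical

/-- Division by `X`, discarding the constant coefficient, as a linear map. -/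
noncomputable def divXLin (F : Type*) [Field F] : Module.End F F[X] where
  toFun := divX
  map_add' f g := by ext; simp [coeff_divX]
  map_smul' c f := by ext; simp [coeff_divX]

section

variable {F : Type*} [Field F]

lemma coeff_divXLin_pow (n : ℕ) (f : F[X]) (i : ℕ) :
    ((divXLin F ^ n) f).coeff i = f.coeff (i + n) := by
  induction n generalizing i with
  | zero => simp
  | succ n ih =>
    rw [pow_succ', Module.End.mul_apply]
    change (divX _).coeff i = _
    rw [coeff_divX, ih]
    congr 1
    ring

lemma natDegree_one_add_divXLin_pow_le (m : ℕ) (f : F[X]) :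
    (((1 + divXLin F) ^ m) f).natDegree ≤ f.natDegree := by
  induction m with
  | zero => simp
  | succ m ih =>
    rw [pow_succ', Module.End.mul_apply]
    refine le_trans ?_ ih
    change (_ + divX _).natDegree ≤ _
    refine (natDegree_add_le _ _).trans (max_le le_rfl ?_)
    rw [natDegree_divX_eq_natDegree_tsub_one]
    exact Nat.sub_le _ _

lemma coeff_zero_collatzT_s11 {f : F[X]} (h : f.coeff 0 ≠ 0) : (collatzT F f).coeff 0 = 0 := by
  simp [collatzT, h, mul_add]

lemma collatzT_collatzT_s11 {f : F[X]} (h : f.coeff 0 ≠ 0) :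
    collatzT F (collatzT F f) = (1 + divXLin F) f := by
  have h1 := coeff_zero_collatzT_s11 h
  rw [collatzT, if_neg (not_not.mpr h1), collatzT, if_pos h]
  change _ = f + divX f
  ext i
  simp [coeff_divX, mul_add, add_comm]

/-- The polynomials of degree at most `d`, with equality only if the constant coefficient
vanishes, are stable under the Collatz map. -/
lemma natDegree_iterate_collatzT {d : ℕ} (hd : 1 ≤ d) {g : F[X]} (hg : g.natDegree ≤ d)
    (hg0 : g.coeff 0 ≠ 0 → g.natDegree < d) (n : ℕ) :
    ((collatzT F)^[n] g).natDegree ≤ d ∧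
      (((collatzT F)^[n] g).coeff 0 ≠ 0 → ((collatzT F)^[n] g).natDegree < d) := by
  induction n with
  | zero => exact ⟨hg, hg0⟩
  | succ n ih =>
    rw [Function.iterate_succ_apply']
    generalize (collatzT F)^[n] g = h at ih
    by_cases h0 : h.coeff 0 = 0
    · have : (collatzT F h).natDegree < d := by
        rw [collatzT, if_neg (not_not.mpr h0), natDegree_divX_eq_natDegree_tsub_one]
        omega
      exact ⟨this.le, fun _ => this⟩
    · refine ⟨?_, fun h2 => absurd (coeff_zero_collatzT_s11 h0) h2⟩
      have := ih.2 h0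
      rw [collatzT, if_pos h0, natDegree_sub_C]
      refine natDegree_mul_le.trans ?_
      have h1 : (X + 1 : F[X]).natDegree = 1 := natDegree_X_add_C 1
      omega

lemma iterate_two_mul_collatzT_s11 {f : F[X]} (h0 : f.coeff 0 ≠ 0) (hd : 1 ≤ f.natDegree)
    (hper : f ∈ Function.periodicPts (collatzT F)) (m : ℕ) :
    (collatzT F)^[2 * m] f = ((1 + divXLin F) ^ m) f ∧
      (((1 + divXLin F) ^ m) f).coeff 0 ≠ 0 := by
  have key (m : ℕ) (hm : (collatzT F)^[2 * m] f = ((1 + divXLin F) ^ m) f) :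
      (((1 + divXLin F) ^ m) f).coeff 0 ≠ 0 := by
    intro hz
    obtain ⟨n, hn, hf⟩ := hper
    have h := natDegree_iterate_collatzT hd (natDegree_one_add_divXLin_pow_le m f)
      (fun h => absurd hz h) (n * (2 * m) - 2 * m)
    rw [← hm, ← Function.iterate_add_apply,
      Nat.sub_add_cancel (Nat.le_mul_of_pos_left _ hn), (hf.mul_const _).eq] at h
    exact lt_irrefl _ (h.2 h0)
  induction m with
  | zero => exact ⟨by simp, by simpa using h0⟩
  | succ m ih =>
    have h1 : (collatzT F)^[2 * (m + 1)] f = ((1 + divXLin F) ^ (m + 1)) f := by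
      rw [show 2 * (m + 1) = 2 * m + 1 + 1 by ring, Function.iterate_succ_apply',
        Function.iterate_succ_apply', ih.1, collatzT_collatzT_s11 ih.2, pow_succ',
        Module.End.mul_apply]
    exact ⟨h1, key _ h1⟩

lemma one_add_divXLin_pow_char_pow (p : ℕ) [Fact p.Prime] [CharP F p] (k : ℕ) (f : F[X]) :
    ((1 + divXLin F) ^ p ^ k) f = f + (divXLin F ^ p ^ k) f := by
  have : CharP (Module.End F F[X]) p :=
    charP_of_injective_algebraMap (algebraMap F (Module.End F F[X])).injective p
  rw [add_pow_char_pow_of_commute p k (Commute.one_left _), one_pow]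
  rfl

lemma one_add_divXLin_pow_char_pow_eq_self_iff (p : ℕ) [Fact p.Prime] [CharP F p] (k : ℕ)
    {f : F[X]} (hf : f ≠ 0) :
    ((1 + divXLin F) ^ p ^ k) f = f ↔ f.natDegree < p ^ k := by
  rw [one_add_divXLin_pow_char_pow, add_eq_left]
  constructor
  · intro h
    by_contra! hle
    have h1 := coeff_divXLin_pow (p ^ k) f (f.natDegree - p ^ k)
    rw [h, coeff_zero, Nat.sub_add_cancel hle] at h1
    exact hf (leadingCoeff_eq_zero.mp h1.symm)
  · intro h
    ext i
    rw [coeff_divXLin_pow, coeff_zero]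
    exact coeff_eq_zero_of_natDegree_lt (by omega)

end

/-- Over a finite field of characteristic `p`, every `T`-periodic polynomial with nonzero
constant coefficient and degree `d ≥ 1` has period `2·p^k` with `k = 1 + ⌊log_p d⌋`. -/
theorem stmt11 (F : Type*) [Field F] [Fintype F] (p : ℕ) [Fact p.Prime] [CharP F p]
    (f : F[X]) (h0 : f.coeff 0 ≠ 0) (hd : 1 ≤ f.natDegree)
    (hper : ∃ n ≥ 1, (collatzT F)^[n] f = f) :
    Function.minimalPeriod (collatzT F) f = 2 * p ^ (1 + Nat.log p f.natDegree) := by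
  have hp : p.Prime := Fact.out
  have hf : f ≠ 0 := by rintro rfl; simp at h0
  have hiter := iterate_two_mul_collatzT_s11 h0 hd hper
  have hmin : (collatzT F)^[Function.minimalPeriod (collatzT F) f] f = f :=
    Function.iterate_minimalPeriod
  have hdvd : Function.minimalPeriod (collatzT F) f ∣ 2 * p ^ (1 + Nat.log p f.natDegree) := by
    apply Function.IsPeriodicPt.minimalPeriod_dvd
    change (collatzT F)^[_] f = f
    rw [(hiter _).1, one_add_divXLin_pow_char_pow_eq_self_iff p _ hf, add_comm]
    exact Nat.lt_pow_succ_log_self hp.one_lt _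
  obtain ⟨m, hm | hm⟩ := Nat.even_or_odd' (Function.minimalPeriod (collatzT F) f)
  · rw [hm] at hdvd hmin ⊢
    obtain ⟨j, hj, rfl⟩ := (Nat.dvd_prime_pow hp).mp (Nat.dvd_of_mul_dvd_mul_left two_pos hdvd)
    rw [(hiter _).1, one_add_divXLin_pow_char_pow_eq_self_iff p _ hf] at hmin
    have := Nat.log_lt_of_lt_pow (by omega) hmin
    rw [show j = 1 + Nat.log p f.natDegree by omega]
  · rw [hm, Function.iterate_succ_apply', (hiter m).1] at hmin
    exact absurd (hmin ▸ coeff_zero_collatzT_s11 (hiter m).2) h0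
end

section
/- Let ℤ₂ be the ring of 2-adic integers, and let φ = (1+√5)/2 and ψ = (1−√5)/2. For every n ≥ 1, the set of f ∈ ℤ₂ whose T-period is exactly n is finite, with cardinality equal to Σ_{d|n} μ(d)·(φ^{n/d} + ψ^{n/d}), where μ is the Möbius function; consequently the number Z_n of T-cycles of length n in ℤ₂ equals (1/n)·Σ_{d|n} μ(d)·(φ^{n/d} + ψ^{n/d}), and Z_n ~ φ^n/n as n → ∞. -/
open scoped Classical

/-- The Collatz map on the 2-adic integers: `T(f) = f/2` if `f ≡ 0 (mod 2)` and
`T(f) = 3f + 1` otherwise.  (When `2 ∣ f`, the cofactor `g` with `f = 2·g` is unique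
since `ℤ₂` is an integral domain.) -/
noncomputable def collatzZ2 (f : PadicInt 2) : PadicInt 2 :=
  if h : ∃ g : PadicInt 2, f = 2 * g then h.choose else 3 * f + 1

namespace CollatzZ2

open Function Filter Topology

/-- The residue map `ℤ₂ → ℤ/2`. -/
noncomputable abbrev parity : PadicInt 2 →+* ZMod 2 := PadicInt.toZMod

lemma parity_eq_zero_iff (x : PadicInt 2) : parity x = 0 ↔ ∃ y, x = 2 * y := by
  rw [← RingHom.mem_ker, PadicInt.ker_toZMod, PadicInt.maximalIdeal_eq_span_p,
    Ideal.mem_span_singleton]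
  rfl

lemma parity_two_mul (x : PadicInt 2) : parity (2 * x) = 0 :=
  (parity_eq_zero_iff _).2 ⟨x, rfl⟩

lemma isUnit_of_parity {x : PadicInt 2} (hx : parity x ≠ 0) : IsUnit x := by
  by_contra h
  exact hx (by
    rwa [← RingHom.mem_ker, PadicInt.ker_toZMod, IsLocalRing.mem_maximalIdeal, mem_nonunits_iff])

lemma zmod_two_ne_zero_iff (a : ZMod 2) : ¬ a = 0 ↔ a = 1 := by
  revert a; decide

lemma exists_three_mul : ∃ u : PadicInt 2, 3 * u = 1 :=
  (isUnit_of_parity (x := 3) (by rw [map_ofNat]; decide)).exists_right_inv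

lemma parity_of_three_mul {u : PadicInt 2} (hu : 3 * u = 1) : parity u = 1 := by
  have h : parity 3 * parity u = 1 := by rw [← map_mul, hu, map_one]
  rw [map_ofNat] at h
  revert h; generalize parity u = a; revert a; decide

lemma collatzZ2_two_mul (x : PadicInt 2) : collatzZ2 (2 * x) = x := by
  have h : ∃ y : PadicInt 2, 2 * x = 2 * y := ⟨x, rfl⟩
  rw [collatzZ2, dif_pos h]
  exact (mul_left_cancel₀ two_ne_zero h.choose_spec).symm

lemma collatzZ2_of_odd {x : PadicInt 2} (hx : parity x = 1) : collatzZ2 x = 3 * x + 1 := by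
  rw [collatzZ2, dif_neg]
  rw [← parity_eq_zero_iff, hx]
  exact one_ne_zero

lemma parity_odd_branch {u : PadicInt 2} (hu : 3 * u = 1) (k : PadicInt 2) :
    parity (u * (2 * k - 1)) = 1 := by
  rw [map_mul, map_sub, parity_two_mul, parity_of_three_mul hu, map_one]; decide

lemma collatzZ2_odd_branch {u : PadicInt 2} (hu : 3 * u = 1) (k : PadicInt 2) :
    collatzZ2 (u * (2 * k - 1)) = 2 * k := by
  rw [collatzZ2_of_odd (parity_odd_branch hu k)]
  linear_combination (2 * k - 1) * hu

lemma exists_odd_branch {u : PadicInt 2} (hu : 3 * u = 1) {x : PadicInt 2} (hx : parity x = 1) :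
    ∃ k, x = u * (2 * k - 1) := by
  obtain ⟨k, hk⟩ := (parity_eq_zero_iff (3 * x + 1)).1 (by
    rw [map_add, map_mul, hx, map_ofNat, map_one]; decide)
  exact ⟨k, by linear_combination (-x) * hu + u * hk⟩

/-- Splitting the solutions of `T^(n+2) x = g x` by the parity of `x`. -/
lemma encard_iterate_add_two {u : PadicInt 2} (hu : 3 * u = 1) (g : PadicInt 2 → PadicInt 2)
    (n : ℕ) :
    {x | collatzZ2^[n + 2] x = g x}.encard =
      {k | collatzZ2^[n + 1] k = g (2 * k)}.encard +
        {k | collatzZ2^[n] k = g (u * (2 * k - 1))}.encard := by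
  have hu0 : u ≠ 0 := right_ne_zero_of_mul_eq_one hu
  have heven : Injective fun k : PadicInt 2 => 2 * k := mul_right_injective₀ two_ne_zero
  have hodd : Injective fun k : PadicInt 2 => u * (2 * k - 1) := fun a b h =>
    heven (sub_left_injective (mul_left_cancel₀ hu0 h))
  rw [← heven.encard_image {k | collatzZ2^[n + 1] k = g (2 * k)},
    ← hodd.encard_image {k | collatzZ2^[n] k = g (u * (2 * k - 1))}, ← Set.encard_union_eq]
  · congr 1
    ext x
    simp only [Set.mem_ofPred_eq, Set.mem_union, Set.mem_image]
    constructor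
    · intro h
      by_cases hx : parity x = 0
      · obtain ⟨k, rfl⟩ := (parity_eq_zero_iff x).1 hx
        rw [iterate_succ_apply, collatzZ2_two_mul] at h
        exact Or.inl ⟨k, h, rfl⟩
      · obtain ⟨k, rfl⟩ := exists_odd_branch hu ((zmod_two_ne_zero_iff _).1 hx)
        rw [iterate_succ_apply, iterate_succ_apply, collatzZ2_odd_branch hu,
          collatzZ2_two_mul] at h
        exact Or.inr ⟨k, h, rfl⟩
    · rintro (⟨k, h, rfl⟩ | ⟨k, h, rfl⟩)
      · rwa [iterate_succ_apply, collatzZ2_two_mul]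
      · rwa [iterate_succ_apply, iterate_succ_apply, collatzZ2_odd_branch hu, collatzZ2_two_mul]
  · rw [Set.disjoint_left]
    rintro _ ⟨k, -, rfl⟩ ⟨l, -, h⟩
    have := congrArg parity h
    simp only [parity_odd_branch hu, parity_two_mul] at this
    exact one_ne_zero this

lemma encard_affine_eq {c d : PadicInt 2} (hc : parity c = 1) :
    {x | c * x = d}.encard = 1 := by
  obtain ⟨v, hv⟩ := (isUnit_of_parity (x := c) (by rw [hc]; exact one_ne_zero)).exists_right_inv
  rw [Set.encard_eq_one]
  refine ⟨v * d, Set.ext fun x => ⟨fun h => ?_, fun h => ?_⟩⟩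
  · simp only [Set.mem_ofPred_eq, Set.mem_singleton_iff] at h ⊢
    linear_combination (-x) * hv + v * h
  · simp only [Set.mem_ofPred_eq, Set.mem_singleton_iff] at h ⊢
    rw [h]; linear_combination d * hv

lemma encard_eq_contraction (a b : PadicInt 2) : {x | x = 2 * a * x + b}.encard = 1 := by
  rw [← encard_affine_eq (c := 1 - 2 * a) (d := b) (by rw [map_sub, parity_two_mul]; simp)]
  congr 1
  ext x
  simp only [Set.mem_ofPred_eq]
  constructor <;> intro h <;> linear_combination h

lemma encard_collatzZ2_eq_contraction_odd (a b : PadicInt 2) (hb : parity b = 1) :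
    {x | collatzZ2 x = 2 * a * x + b}.encard = 1 := by
  have : {x | collatzZ2 x = 2 * a * x + b} =
      (fun k => 2 * k) '' {k | k = 2 * (2 * a) * k + b} := by
    ext x
    simp only [Set.mem_ofPred_eq, Set.mem_image]
    constructor
    · intro h
      by_cases hx : parity x = 0
      · obtain ⟨k, rfl⟩ := (parity_eq_zero_iff x).1 hx
        rw [collatzZ2_two_mul] at h
        exact ⟨k, by linear_combination h, rfl⟩
      · rw [zmod_two_ne_zero_iff] at hx
        rw [collatzZ2_of_odd hx] at h
        have := congrArg parity h
        rw [mul_assoc 2 a x, map_add, map_add, map_mul, parity_two_mul, hx, hb, map_ofNat,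
          map_one] at this
        exact absurd this (by decide)
    · rintro ⟨k, h, rfl⟩
      rw [collatzZ2_two_mul]
      linear_combination h
  rw [this, (mul_right_injective₀ two_ne_zero).encard_image, encard_eq_contraction]

lemma encard_collatzZ2_eq_contraction_even (a b : PadicInt 2) (hb : parity b = 0) :
    {x | collatzZ2 x = 2 * a * x + b}.encard = 2 := by
  have : {x | collatzZ2 x = 2 * a * x + b} =
      (fun k => 2 * k) '' {k | k = 2 * (2 * a) * k + b} ∪ {x | (3 - 2 * a) * x = b - 1} := by
    ext x
    simp only [Set.mem_ofPred_eq, Set.mem_image, Set.mem_union]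
    constructor
    · intro h
      by_cases hx : parity x = 0
      · obtain ⟨k, rfl⟩ := (parity_eq_zero_iff x).1 hx
        rw [collatzZ2_two_mul] at h
        exact Or.inl ⟨k, by linear_combination h, rfl⟩
      · rw [zmod_two_ne_zero_iff] at hx
        rw [collatzZ2_of_odd hx] at h
        exact Or.inr (by linear_combination h)
    · rintro (⟨k, h, rfl⟩ | h)
      · rw [collatzZ2_two_mul]
        linear_combination h
      · rw [collatzZ2_of_odd (parity_solution h)]
        linear_combination h
  rw [this, Set.encard_union_eq, (mul_right_injective₀ two_ne_zero).encard_image,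
    encard_eq_contraction, encard_affine_eq (parity_coeff a), one_add_one_eq_two]
  rw [Set.disjoint_left]
  rintro _ ⟨k, -, rfl⟩ h
  have := parity_solution h
  rw [parity_two_mul] at this
  exact zero_ne_one this
where
  parity_coeff (a : PadicInt 2) : parity (3 - 2 * a) = 1 := by
    rw [map_sub, parity_two_mul, map_ofNat]; decide
  parity_solution {x : PadicInt 2} (h : (3 - 2 * a) * x = b - 1) : parity x = 1 := by
    have := congrArg parity h
    rw [map_mul, parity_coeff, one_mul, map_sub, hb, map_one] at this
    rw [this]; decide

/-- The number of solutions of `T^n x = 2 a x + b` with `b` even, respectively odd. -/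
lemma encard_iterate_eq_contraction (n : ℕ) (a b : PadicInt 2) :
    {x | collatzZ2^[n] x = 2 * a * x + b}.encard =
      if parity b = 0 then (Nat.fib (n + 2) : ℕ∞) else (Nat.fib (n + 1) : ℕ∞) := by
  obtain ⟨u, hu⟩ := exists_three_mul
  induction n using Nat.twoStepInduction generalizing a b with
  | zero => simp [encard_eq_contraction]
  | one =>
    split_ifs with hb
    · simpa [Nat.fib] using encard_collatzZ2_eq_contraction_even a b hb
    · simpa [Nat.fib] using
        encard_collatzZ2_eq_contraction_odd a b ((zmod_two_ne_zero_iff _).1 hb)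
  | more n ih0 ih1 =>
    have h1 := ih1 (2 * a) b
    have h0 := ih0 (2 * a * u) (b - 2 * (a * u))
    rw [map_sub, parity_two_mul, sub_zero] at h0
    have e1 : ∀ k, 2 * a * (2 * k) + b = 2 * (2 * a) * k + b := fun k => by ring
    have e0 : ∀ k, 2 * a * (u * (2 * k - 1)) + b = 2 * (2 * a * u) * k + (b - 2 * (a * u)) :=
      fun k => by ring
    rw [encard_iterate_add_two hu fun x => 2 * a * x + b]
    simp only [e1, e0]
    rw [h1, h0]
    split_ifs
    · rw [← Nat.cast_add, Nat.fib_add_two (n := n + 2), add_comm (Nat.fib (n + 2))]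
    · rw [← Nat.cast_add, Nat.fib_add_two (n := n + 1), add_comm (Nat.fib (n + 1))]

lemma encard_fixed_iterate (n : ℕ) :
    {x | collatzZ2^[n + 1] x = x}.encard = ((Nat.fib (n + 2) + Nat.fib n : ℕ) : ℕ∞) := by
  obtain ⟨u, hu⟩ := exists_three_mul
  cases n with
  | zero =>
    simp only [zero_add, iterate_one, Nat.fib_two, Nat.fib_zero, add_zero, Nat.cast_one]
    rw [Set.encard_eq_one]
    refine ⟨0, Set.ext fun x => ?_⟩
    simp only [Set.mem_ofPred_eq, Set.mem_singleton_iff]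
    constructor
    · intro h
      by_cases hx : parity x = 0
      · obtain ⟨k, rfl⟩ := (parity_eq_zero_iff x).1 hx
        rw [collatzZ2_two_mul] at h
        have : k = 0 := by linear_combination -h
        rw [this, mul_zero]
      · rw [zmod_two_ne_zero_iff] at hx
        rw [collatzZ2_of_odd hx] at h
        have := congrArg parity h
        rw [map_add, map_mul, hx, map_ofNat, map_one] at this
        exact absurd this (by decide)
    · rintro rfl
      simpa using collatzZ2_two_mul 0
  | succ n =>
    have h1 := encard_iterate_eq_contraction (n + 1) 1 0
    have h0 := encard_iterate_eq_contraction n u (-u)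
    rw [map_neg, parity_of_three_mul hu, if_neg (by decide)] at h0
    rw [map_zero, if_pos rfl] at h1
    have e1 : ∀ k : PadicInt 2, 2 * k = 2 * 1 * k + 0 := fun k => by ring
    have e0 : ∀ k : PadicInt 2, u * (2 * k - 1) = 2 * u * k + -u := fun k => by ring
    rw [encard_iterate_add_two hu fun x => x]
    simp only [e0]
    rw [h0, Nat.cast_add, ← h1]
    simp

lemma goldenRatio_pow_add_goldenConj_pow (n : ℕ) :
    Real.goldenRatio ^ (n + 1) + Real.goldenConj ^ (n + 1) = (Nat.fib (n + 2) + Nat.fib n : ℕ) := by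
  induction n using Nat.twoStepInduction with
  | zero => simp
  | one =>
    simp only [one_add_one_eq_two, Real.goldenRatio_sq, Real.goldenConj_sq]
    have := Real.goldenRatio_add_goldenConj
    norm_num [Nat.fib]
    linarith
  | more n h0 h1 =>
    have e : ∀ m, Nat.fib (m + 2) = Nat.fib m + Nat.fib (m + 1) := fun m => Nat.fib_add_two
    have hn : (Nat.fib (n + 2 + 2) + Nat.fib (n + 2) : ℕ) =
        (Nat.fib (n + 1 + 2) + Nat.fib (n + 1)) + (Nat.fib (n + 2) + Nat.fib n) := by
      rw [e (n + 2), e n]; ring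
    rw [hn, Nat.cast_add, ← h0, ← h1]
    linear_combination Real.goldenRatio ^ (n + 1) * Real.goldenRatio_sq +
      Real.goldenConj ^ (n + 1) * Real.goldenConj_sq

/-- The number of points fixed by `T^n`, as a real number. -/
noncomputable def lucas (n : ℕ) : ℝ := Real.goldenRatio ^ n + Real.goldenConj ^ n

/-- The number of points of exact `T`-period `n`, as a real number. -/
noncomputable def exactCount (n : ℕ) : ℝ := ({f | minimalPeriod collatzZ2 f = n}.ncard : ℝ)

lemma finite_isPeriodicPt {n : ℕ} (hn : 0 < n) : {f | IsPeriodicPt collatzZ2 n f}.Finite := by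
  obtain ⟨m, rfl⟩ := Nat.exists_eq_succ_of_ne_zero hn.ne'
  exact Set.finite_of_encard_eq_coe (encard_fixed_iterate m)

lemma ncard_isPeriodicPt {n : ℕ} (hn : 0 < n) :
    ({f | IsPeriodicPt collatzZ2 n f}.ncard : ℝ) = lucas n := by
  obtain ⟨m, rfl⟩ := Nat.exists_eq_succ_of_ne_zero hn.ne'
  have h : {f | IsPeriodicPt collatzZ2 (m + 1) f}.encard = _ := encard_fixed_iterate m
  rw [lucas, goldenRatio_pow_add_goldenConj_pow, Set.ncard, h, ENat.toNat_natCast]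

lemma finite_minimalPeriod {n : ℕ} (hn : 0 < n) :
    {f | minimalPeriod collatzZ2 f = n}.Finite :=
  (finite_isPeriodicPt hn).subset fun f hf => by
    rw [Set.mem_ofPred_eq] at hf ⊢
    rw [← hf]; exact isPeriodicPt_minimalPeriod _ _

lemma sum_divisors_exactCount {n : ℕ} (hn : 0 < n) :
    ∑ d ∈ n.divisors, exactCount d = lucas n := by
  have hfin := finite_isPeriodicPt hn
  rw [← ncard_isPeriodicPt hn, Set.ncard_eq_toFinset_card _ hfin,
    Finset.card_eq_sum_card_fiberwise (f := minimalPeriod collatzZ2) (t := n.divisors), Nat.cast_sum]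
  · refine Finset.sum_congr rfl fun d hd => ?_
    rw [exactCount, Set.ncard_eq_toFinset_card _ (finite_minimalPeriod (Nat.pos_of_mem_divisors hd))]
    congr 2
    ext f
    simp only [Set.Finite.mem_toFinset, Set.mem_ofPred_eq, Finset.mem_filter]
    refine ⟨fun h => ⟨?_, h⟩, fun h => h.2⟩
    exact isPeriodicPt_iff_minimalPeriod_dvd.2 (h ▸ Nat.dvd_of_mem_divisors hd)
  · intro f hf
    simp only [Set.Finite.coe_toFinset, Set.mem_ofPred_eq] at hf
    simp only [Finset.mem_coe, Nat.mem_divisors]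
    exact ⟨isPeriodicPt_iff_minimalPeriod_dvd.1 hf, hn.ne'⟩

lemma exactCount_eq_sum_moebius {n : ℕ} (hn : 0 < n) :
    exactCount n = ∑ d ∈ n.divisors, (ArithmeticFunction.moebius d : ℝ) * lucas (n / d) := by
  have h := (ArithmeticFunction.sum_eq_iff_sum_mul_moebius_eq
    (f := exactCount) (g := lucas)).1 (fun m hm => sum_divisors_exactCount hm) n hn
  rw [← h, Nat.sum_divisorsAntidiagonal
    (f := fun i j => (ArithmeticFunction.moebius i : ℝ) * lucas j)]

lemma exactCount_nonneg (n : ℕ) : 0 ≤ exactCount n := Nat.cast_nonneg _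

lemma abs_goldenConj_le : |Real.goldenConj| ≤ 1 :=
  abs_le.2 ⟨Real.neg_one_lt_goldenConj.le, Real.goldenConj_neg.le.trans zero_le_one⟩

lemma lucas_le (n : ℕ) : lucas n ≤ 2 * Real.goldenRatio ^ n := by
  have h1 : Real.goldenConj ^ n ≤ 1 :=
    (le_abs_self _).trans (by rw [abs_pow]; exact pow_le_one₀ (abs_nonneg _) abs_goldenConj_le)
  have h2 : 1 ≤ Real.goldenRatio ^ n := one_le_pow₀ Real.one_lt_goldenRatio.le
  rw [lucas]; linarith

lemma exactCount_le_lucas {n : ℕ} (hn : 0 < n) : exactCount n ≤ lucas n := by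
  rw [← sum_divisors_exactCount hn]
  exact Finset.single_le_sum (fun d _ => exactCount_nonneg d) (Nat.mem_divisors_self n hn.ne')

lemma goldenRatio_pow_half_le (n : ℕ) :
    Real.goldenRatio ^ (n / 2) ≤ √Real.goldenRatio ^ n := by
  have h : Real.goldenRatio ^ (n / 2) = √Real.goldenRatio ^ (2 * (n / 2)) := by
    rw [pow_mul, Real.sq_sqrt Real.goldenRatio_pos.le]
  rw [h]
  exact pow_le_pow_right₀ (Real.one_le_sqrt.2 Real.one_lt_goldenRatio.le) (Nat.mul_div_le n 2)

lemma lucas_sub_exactCount_le {n : ℕ} (hn : 0 < n) :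
    lucas n - exactCount n ≤ 2 * (n * √Real.goldenRatio ^ n) := by
  rw [← sum_divisors_exactCount hn, ← Nat.cons_self_properDivisors hn.ne', Finset.sum_cons,
    add_sub_cancel_left]
  have hbound : ∀ d ∈ n.properDivisors, exactCount d ≤ 2 * √Real.goldenRatio ^ n := by
    intro d hd
    obtain ⟨⟨k, rfl⟩, hlt⟩ := Nat.mem_properDivisors.1 hd
    have hd0 : 0 < d := Nat.pos_of_mul_pos_right hn
    have hk : 2 ≤ k := by
      by_contra! hk
      interval_cases k <;> omega
    have hle : d ≤ d * k / 2 := by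
      rw [Nat.le_div_iff_mul_le two_pos]; exact Nat.mul_le_mul_left d hk
    calc exactCount d ≤ 2 * Real.goldenRatio ^ d := (exactCount_le_lucas hd0).trans (lucas_le d)
      _ ≤ 2 * Real.goldenRatio ^ (d * k / 2) := by
        gcongr; exact Real.one_lt_goldenRatio.le
      _ ≤ _ := by gcongr; exact goldenRatio_pow_half_le _
  have hcard : n.properDivisors.card ≤ n :=
    (Finset.card_le_card (Finset.filter_subset _ _)).trans (by simp)
  calc ∑ d ∈ n.properDivisors, exactCount d
      ≤ n.properDivisors.card * (2 * √Real.goldenRatio ^ n) := by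
        rw [← nsmul_eq_mul]; exact Finset.sum_le_card_nsmul _ _ _ hbound
    _ ≤ n * (2 * √Real.goldenRatio ^ n) := by gcongr
    _ = _ := by ring

lemma tendsto_lucas_div : Tendsto (fun n => lucas n / Real.goldenRatio ^ n) atTop (𝓝 1) := by
  have h : |Real.goldenConj / Real.goldenRatio| < 1 := by
    rw [abs_div, abs_of_pos Real.goldenRatio_pos, div_lt_one Real.goldenRatio_pos]
    exact abs_goldenConj_le.trans_lt Real.one_lt_goldenRatio
  have := (tendsto_pow_atTop_nhds_zero_of_abs_lt_one h).const_add 1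
  rw [add_zero] at this
  refine this.congr fun n => ?_
  rw [lucas, add_div, div_self (pow_ne_zero _ Real.goldenRatio_ne_zero), div_pow]

lemma tendsto_exactCount_div :
    Tendsto (fun n => exactCount n / Real.goldenRatio ^ n) atTop (𝓝 1) := by
  have hs : 1 < √Real.goldenRatio := by
    rw [Real.lt_sqrt zero_le_one, one_pow]; exact Real.one_lt_goldenRatio
  have hlim := (tendsto_self_mul_const_pow_of_lt_one (inv_nonneg.2 (Real.sqrt_nonneg _))
    (inv_lt_one_of_one_lt₀ hs)).const_mul 2
  rw [mul_zero] at hlim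
  have hlow := tendsto_lucas_div.sub hlim
  rw [sub_zero] at hlow
  refine tendsto_of_tendsto_of_tendsto_of_le_of_le' hlow tendsto_lucas_div ?_ ?_
  · filter_upwards [eventually_gt_atTop 0] with n hn
    have hpow : Real.goldenRatio ^ n = √Real.goldenRatio ^ n * √Real.goldenRatio ^ n := by
      rw [← mul_pow, Real.mul_self_sqrt Real.goldenRatio_pos.le]
    have hs0 : √Real.goldenRatio ^ n ≠ 0 := pow_ne_zero _ (zero_lt_one.trans hs).ne'
    have e : 2 * ((n : ℝ) * (√Real.goldenRatio)⁻¹ ^ n) =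
        2 * (n * √Real.goldenRatio ^ n) / Real.goldenRatio ^ n := by
      rw [hpow, inv_pow]; field_simp
    rw [e, ← sub_div]
    have := lucas_sub_exactCount_le hn
    have := pow_pos Real.goldenRatio_pos n
    gcongr
    linarith
  · filter_upwards [eventually_gt_atTop 0] with n hn
    have := pow_pos Real.goldenRatio_pos n
    gcongr
    exact exactCount_le_lucas hn

end CollatzZ2

/-- With `φ = (1+√5)/2` and `ψ = (1−√5)/2`: for every `n ≥ 1` the set of 2-adic integers
of `T`-period exactly `n` is finite of cardinality `Σ_{d∣n} μ(d)(φ^{n/d} + ψ^{n/d})`;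
consequently the number `Zₙ` of `T`-cycles of length `n` equals
`(1/n)·Σ_{d∣n} μ(d)(φ^{n/d} + ψ^{n/d})`, and `Zₙ ~ φⁿ/n` as `n → ∞` (equivalently, the
cardinality above is asymptotic to `φⁿ`). -/
theorem stmt19 :
    (∀ n : ℕ, 1 ≤ n →
      {f : PadicInt 2 | Function.minimalPeriod collatzZ2 f = n}.Finite ∧
      ({f : PadicInt 2 | Function.minimalPeriod collatzZ2 f = n}.ncard : ℝ) =
        ∑ d ∈ n.divisors, (ArithmeticFunction.moebius d : ℝ) *
          (((1 + Real.sqrt 5) / 2) ^ (n / d) + ((1 - Real.sqrt 5) / 2) ^ (n / d)) ∧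
      ({f : PadicInt 2 | Function.minimalPeriod collatzZ2 f = n}.ncard : ℝ) / n =
        (1 / n) * ∑ d ∈ n.divisors, (ArithmeticFunction.moebius d : ℝ) *
          (((1 + Real.sqrt 5) / 2) ^ (n / d) + ((1 - Real.sqrt 5) / 2) ^ (n / d))) ∧
    Filter.Tendsto
      (fun n : ℕ =>
        ({f : PadicInt 2 | Function.minimalPeriod collatzZ2 f = n}.ncard : ℝ) /
          ((1 + Real.sqrt 5) / 2) ^ n)
      Filter.atTop (nhds 1) := by
  refine ⟨fun n hn => ?_, CollatzZ2.tendsto_exactCount_div⟩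
  have h := CollatzZ2.exactCount_eq_sum_moebius hn
  refine ⟨CollatzZ2.finite_minimalPeriod hn, h, ?_⟩
  rw [div_eq_mul_one_div, mul_comm]
  exact congrArg _ h
end
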